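/- Let R be a commutative ring, n ≥ 1, κ = (κ₁,…,κ_n) positive integers with N = κ₁+⋯+κ_n, y₁,…,y_n ∈ R, and λ a partition of length ≤ N. Then the matrix identity G_λ(y,κ) = J_λ(y^[κ]) · M(y,κ) holds. -/

import Mathlib

open scoped BigOperators

/-- Complete homogeneous polynomial of degree `m` evaluated at the list `l`
(`h₀ = 1`, `h_m = 0` for `m < 0`). -/
def homEval {R : Type*} [CommRing R] (l : List R) (m : ℤ) : R :=
  if 0 ≤ m then
    ∑ f ∈ Finset.Nat.antidiagonalTuple l.length m.toNat, ∏ i, l.get i ^ f i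
  else 0

/-- Elementary symmetric polynomial of degree `k` evaluated at the list `l`. -/
def esymmEval {R : Type*} [CommRing R] (l : List R) (k : ℕ) : R :=
  (((l : Multiset R).powersetCard k).map Multiset.prod).sum

/-- Power sum of degree `s` evaluated at the list `l`. -/
def psumEval {R : Type*} [CommRing R] (l : List R) (s : ℕ) : R :=
  (l.map (· ^ s)).sum

/-- The list `y^[κ]`: `y q` repeated `κ q` times, in order. -/
def repList {R : Type*} {n : ℕ} (y : Fin n → R) (κ : Fin n → ℕ) : List R :=
  (List.ofFn fun q => List.replicate (κ q) (y q)).flatten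

/-- Zero-based version of `γ(κ, p) = (q, r)`: the `p`-th entry (0-based) of the list
    `(0,0),…,(0,κ₀−1),(1,0),…,(1,κ₁−1),…`. -/
def gammaPair (n : ℕ) (κ : Fin n → ℕ) (p : ℕ) : ℕ × ℕ :=
  ((List.ofFn fun q : Fin n => (List.range (κ q)).map fun r => ((q : ℕ), r)).flatten).getD p (0, 0)

/-- The generalized confluent Vandermonde matrix `G_λ(y, κ)` (zero-based indices):
`G[j,p] = binom(N+λ_j−j−1, r) · y_q^(N+λ_j−j−r−1)` if the exponent is `≥ 0`, else `0`,
where `(q, r) = gammaPair n κ p`. -/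
def vanG (R : Type*) [CommRing R] {n : ℕ} (N : ℕ) (κ : Fin n → ℕ) (y : Fin n → R)
    (lam : Fin N → ℕ) : Matrix (Fin N) (Fin N) R :=
  Matrix.of fun j p =>
    if h : (gammaPair n κ (p : ℕ)).1 < n ∧
        (j : ℕ) + (gammaPair n κ (p : ℕ)).2 + 1 ≤ N + lam j then
      (Nat.choose (N + lam j - ((j : ℕ) + 1)) (gammaPair n κ (p : ℕ)).2 : R) *
        y ⟨(gammaPair n κ (p : ℕ)).1, h.1⟩ ^
          (N + lam j - ((j : ℕ) + (gammaPair n κ (p : ℕ)).2 + 1))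
    else 0

/-- The Jacobi–Trudi matrix `J_λ(x) = [h_{λ_j − j + k}(x)]`. -/
def jacobiTrudi (R : Type*) [CommRing R] (N : ℕ) (lam : Fin N → ℕ) (x : List R) :
    Matrix (Fin N) (Fin N) R :=
  Matrix.of fun j k => homEval x ((lam j : ℤ) - (j : ℕ) + (k : ℕ))

/-- The matrix `M(y, κ)` with entries `(−1)^{N−k−r+1} e_{N−k−r+1}(y^[κ − r b_q])`
(in one-based form); entries with `N−k−r+1 < 0` are `0`. -/
def matM (R : Type*) [CommRing R] {n : ℕ} (N : ℕ) (κ : Fin n → ℕ) (y : Fin n → R) :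
    Matrix (Fin N) (Fin N) R :=
  Matrix.of fun k p =>
    if h : (gammaPair n κ (p : ℕ)).1 < n ∧
        (k : ℕ) + (gammaPair n κ (p : ℕ)).2 + 1 ≤ N then
      (-1 : R) ^ (N - ((k : ℕ) + (gammaPair n κ (p : ℕ)).2 + 1)) *
        esymmEval
          (repList y (Function.update κ ⟨(gammaPair n κ (p : ℕ)).1, h.1⟩
            (κ ⟨(gammaPair n κ (p : ℕ)).1, h.1⟩ - ((gammaPair n κ (p : ℕ)).2 + 1))))
          (N - ((k : ℕ) + (gammaPair n κ (p : ℕ)).2 + 1))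
    else 0

/-- The column vector `H^N_{s,λ}(l) = (h_{s + λ_j − j}(l))_{j=1}^N` (one-based `j`). -/
def Hcol {R : Type*} [CommRing R] {N : ℕ} (lam : Fin N → ℕ) (s : ℕ) (l : List R) :
    Fin N → R :=
  fun j => homEval l ((s : ℤ) + lam j - ((j : ℕ) + 1))

section GeneratingFunctions

open PowerSeries

variable {R : Type*} [CommRing R]

theorem homEval_of_neg (l : List R) {m : ℤ} (hm : m < 0) : homEval l m = 0 :=
  if_neg (not_le.mpr hm)

theorem esymmEval_of_length_lt (l : List R) {k : ℕ} (hk : l.length < k) : esymmEval l k = 0 := by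
  simp [esymmEval, Multiset.powersetCard_eq_empty k (s := (l : Multiset R)) (by simpa using hk)]

/-- The reciprocal of `(1 - aX) ^ (r + 1)` as an explicit power series. -/
theorem mk_choose_mul_pow_mul_one_sub_pow (a : R) (r : ℕ) :
    (mk fun m => ((r + m).choose r : R) * a ^ m) * (1 - C a * X) ^ (r + 1) = 1 := by
  have h := congrArg (rescale a) (mk_add_choose_mul_one_sub_pow_eq_one R r)
  simp only [map_mul, map_pow, map_sub, map_one, rescale_mk, rescale_X] at h
  simpa only [mul_comm] using h

theorem mk_homEval_eq_prod (l : List R) :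
    (mk fun m : ℕ => homEval l m) = (l.map fun a => mk fun m => a ^ m).prod := by
  have hprod : (l.map fun a => (mk fun m => a ^ m : R⟦X⟧)).prod =
      ∏ i : Fin l.length, mk fun m => l.get i ^ m := by
    rw [← List.prod_ofFn]
    congr 1
    apply List.ext_getElem <;> simp
  ext m
  rw [hprod, coeff_prod, coeff_mk, homEval, if_pos (Int.natCast_nonneg m), Int.toNat_natCast]
  symm
  refine Finset.sum_bij' (fun f _ => ⇑f) (fun f _ => Finsupp.equivFunOnFinite.symm f)
    ?_ ?_ ?_ ?_ ?_
  all_goals simp [Finset.Nat.mem_antidiagonalTuple]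

theorem mk_homEval_mul_prod (l : List R) :
    (mk fun m : ℕ => homEval l m) * (l.map fun a => 1 - C a * X).prod = 1 := by
  rw [mk_homEval_eq_prod, ← List.prod_map_mul]
  apply List.prod_eq_one
  simp only [List.mem_map, forall_exists_index, and_imp]
  rintro _ a - rfl
  simpa using mk_choose_mul_pow_mul_one_sub_pow a 0

theorem coeff_prod_one_sub (l : List R) (k : ℕ) :
    coeff k (l.map fun a => 1 - C a * X).prod = (-1) ^ k * esymmEval l k := by
  induction l generalizing k with
  | nil =>
    cases k <;> simp [esymmEval, coeff_one, Multiset.powersetCard_zero_right]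
  | cons a l ih =>
    rw [List.map_cons, List.prod_cons, sub_mul, one_mul, map_sub, mul_assoc, coeff_C_mul]
    cases k with
    | zero => simp [ih, esymmEval]
    | succ k =>
      have hcons : esymmEval (a :: l) (k + 1) = esymmEval l (k + 1) + a * esymmEval l k := by
        simp [esymmEval, ← Multiset.cons_coe, Multiset.powersetCard_cons, Multiset.sum_map_mul_left]
      rw [coeff_succ_X_mul, ih, ih, hcons]
      ring

/-- A truncated convolution of the complete homogeneous and signed elementary polynomials is a
coefficient of the product of their generating functions. -/
theorem sum_homEval_mul_esymmEval (l l' : List R) {d : ℕ} (hd : l'.length ≤ d) (a : ℤ) :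
    ∑ i ∈ Finset.range (d + 1), homEval l (a - i) * ((-1) ^ i * esymmEval l' i) =
      if 0 ≤ a then coeff a.toNat
        ((mk fun m : ℕ => homEval l m) * (l'.map fun a => 1 - C a * X).prod) else 0 := by
  split_ifs with ha
  · lift a to ℕ using ha
    rw [mul_comm (mk _), coeff_mul, Finset.Nat.sum_antidiagonal_eq_sum_range_succ_mk,
      Int.toNat_natCast]
    simp only [coeff_prod_one_sub, coeff_mk]
    trans ∑ i ∈ Finset.range (max d a + 1), homEval l (a - i) * ((-1) ^ i * esymmEval l' i)
    · apply Finset.sum_subset (by intro; simp; omega)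
      intro i _ hi
      rw [esymmEval_of_length_lt l' (by simp at hi; omega), mul_zero, mul_zero]
    · symm
      rw [Nat.succ_eq_add_one]
      trans ∑ i ∈ Finset.range (a + 1), homEval l (a - i) * ((-1) ^ i * esymmEval l' i)
      · refine Finset.sum_congr rfl fun i hi => ?_
        rw [Nat.cast_sub (by simp at hi; omega), mul_comm]
      · apply Finset.sum_subset (by intro; simp; omega)
        intro i _ hi
        rw [homEval_of_neg l (by simp at hi; omega), zero_mul]
  · exact Finset.sum_eq_zero fun i _ => by rw [homEval_of_neg l (by omega), zero_mul]

end GeneratingFunctions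

theorem length_repList {R : Type*} {n : ℕ} (y : Fin n → R) (κ : Fin n → ℕ) :
    (repList y κ).length = ∑ q, κ q := by
  simp [repList, List.length_flatten, List.map_ofFn, List.sum_ofFn]

theorem prod_map_repList {R S : Type*} [CommMonoid S] {n : ℕ} (y : Fin n → R) (κ : Fin n → ℕ)
    (f : R → S) : ((repList y κ).map f).prod = ∏ q, f (y q) ^ κ q := by
  simp [repList, List.map_flatten, List.prod_flatten, List.map_ofFn, List.prod_ofFn]

theorem prod_map_repList_update {R S : Type*} [CommMonoid S] {n : ℕ} (y : Fin n → R)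
    (κ : Fin n → ℕ) (f : R → S) (q : Fin n) {r : ℕ} (hr : r ≤ κ q) :
    ((repList y (Function.update κ q (κ q - r))).map f).prod * f (y q) ^ r =
      ((repList y κ).map f).prod := by
  rw [prod_map_repList, prod_map_repList, ← Finset.mul_prod_erase _ _ (Finset.mem_univ q),
    ← Finset.mul_prod_erase _ (fun i => f (y i) ^ κ i) (Finset.mem_univ q), Function.update_self,
    mul_right_comm, ← pow_add, Nat.sub_add_cancel hr]
  congr 1
  refine Finset.prod_congr rfl fun i hi => ?_
  rw [Function.update_of_ne (Finset.ne_of_mem_erase hi)]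

theorem length_repList_update {R : Type*} {n : ℕ} (y : Fin n → R) (κ : Fin n → ℕ) (q : Fin n)
    {r : ℕ} (hr : r ≤ κ q) :
    (repList y (Function.update κ q (κ q - r))).length = ∑ i, κ i - r := by
  rw [length_repList, ← Finset.add_sum_erase _ _ (Finset.mem_univ q),
    ← Finset.add_sum_erase _ κ (Finset.mem_univ q), Function.update_self,
    Finset.sum_congr rfl fun i hi => Function.update_of_ne (Finset.ne_of_mem_erase hi) _ κ]
  change _ + ∑ i ∈ Finset.univ.erase q, κ i = _
  omega

theorem exists_gammaPair_eq {n : ℕ} (κ : Fin n → ℕ) {p : ℕ} (hp : p < ∑ q, κ q) :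
    ∃ q : Fin n, ∃ r < κ q, gammaPair n κ p = ((q : ℕ), r) := by
  set l := (List.ofFn fun q : Fin n => (List.range (κ q)).map fun r => ((q : ℕ), r)).flatten
    with hl
  have hlen : p < l.length := by
    simpa [hl, List.length_flatten, List.map_ofFn, List.sum_ofFn] using hp
  have hmem : gammaPair n κ p ∈ l := by
    rw [gammaPair, ← hl, List.getD_eq_getElem _ _ hlen]
    exact List.getElem_mem hlen
  simp only [hl, List.mem_flatten, List.mem_ofFn] at hmem
  obtain ⟨_, ⟨q, rfl⟩, hq⟩ := hmem
  obtain ⟨r, hr, h⟩ := List.mem_map.mp hq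
  exact ⟨q, r, List.mem_range.mp hr, h.symm⟩

/-- Dividing the generating function of the `h_m(y^[κ])` by that of `y^[κ - (r+1) b_q]` leaves
`(1 - y_q X) ^ (-(r+1))`. -/
theorem mk_homEval_mul_prod_update {R : Type*} [CommRing R] {n : ℕ} (y : Fin n → R)
    (κ : Fin n → ℕ) (q : Fin n) {r : ℕ} (hr : r < κ q) :
    (PowerSeries.mk fun m : ℕ => homEval (repList y κ) m) *
      ((repList y (Function.update κ q (κ q - (r + 1)))).map
        fun a => 1 - PowerSeries.C a * PowerSeries.X).prod =
      PowerSeries.mk fun m => ((r + m).choose r : R) * y q ^ m := by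
  have hprod := prod_map_repList_update y κ
    (fun a => (1 - PowerSeries.C a * PowerSeries.X : PowerSeries R)) q (Nat.succ_le_of_lt hr)
  have hhom := mk_homEval_mul_prod (repList y κ)
  have hinv := mk_choose_mul_pow_mul_one_sub_pow (y q) r
  rw [← hprod, ← mul_assoc] at hhom
  exact (left_inv_eq_right_inv hinv ((mul_comm _ _).trans hhom)).symm

/-- the matrix identity `G_λ(y,κ) = J_λ(y^[κ]) · M(y,κ)`. -/
theorem vanG_eq_jacobiTrudi_mul_matM {R : Type*} [CommRing R]
    (n : ℕ) (hn : 1 ≤ n) (κ : Fin n → ℕ) (hκ : ∀ q, 0 < κ q)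
    (N : ℕ) (hN : N = ∑ q, κ q) (y : Fin n → R)
    (lam : Fin N → ℕ) (hlam : Antitone lam) :
    vanG R N κ y lam = jacobiTrudi R N lam (repList y κ) * matM R N κ y := by
  subst hN
  ext j p
  obtain ⟨q, r, hr, hγ⟩ := exists_gammaPair_eq κ p.isLt
  have hrN : r + 1 ≤ ∑ i, κ i :=
    hr.trans_le (Finset.single_le_sum (fun i _ => Nat.zero_le (κ i)) (Finset.mem_univ q))
  obtain ⟨d, hd⟩ := Nat.exists_eq_add_of_le hrN
  have hlen := length_repList_update y κ q (r := r + 1) hr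
  have hsum := sum_homEval_mul_esymmEval (repList y κ)
    (repList y (Function.update κ q (κ q - (r + 1)))) (d := d) (by omega) ((lam j : ℤ) - j + d)
  rw [mk_homEval_mul_prod_update y κ q hr] at hsum
  simp only [Matrix.mul_apply, vanG, jacobiTrudi, matM, Matrix.of_apply, hγ, q.isLt, true_and,
    Fin.eta, dite_eq_ite]
  trans ∑ i ∈ Finset.range (d + 1), homEval (repList y κ) ((lam j : ℤ) - j + d - i) *
    ((-1) ^ i * esymmEval (repList y (Function.update κ q (κ q - (r + 1)))) i)
  · rw [hsum]
    by_cases hle : (j : ℕ) + r + 1 ≤ ∑ i, κ i + lam j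
    · obtain ⟨m, hm⟩ := Nat.exists_eq_add_of_le hle
      have hm' : ((lam j : ℤ) - j + d) = m := by omega
      rw [if_pos hle, hm', if_pos (Int.natCast_nonneg m), Int.toNat_natCast, PowerSeries.coeff_mk]
      congr 3 <;> omega
    · rw [if_neg hle, if_neg (by omega)]
  · rw [Fin.sum_univ_eq_sum_range (fun k => homEval (repList y κ) ((lam j : ℤ) - j + k) *
      if k + r + 1 ≤ ∑ i, κ i then (-1) ^ (∑ i, κ i - (k + r + 1)) *
        esymmEval (repList y (Function.update κ q (κ q - (r + 1)))) (∑ i, κ i - (k + r + 1))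
      else 0), ← Finset.sum_range_reflect]
    symm
    rw [← Finset.sum_subset (s₁ := Finset.range (d + 1)) (by intro; simp; omega)]
    · refine Finset.sum_congr rfl fun k hk => ?_
      have hk' : k < d + 1 := Finset.mem_range.mp hk
      rw [if_pos (by omega), show ∑ i, κ i - (k + r + 1) = d + 1 - 1 - k by omega,
        show (lam j : ℤ) - j + d - ((d + 1 - 1 - k : ℕ) : ℤ) = lam j - j + k by omega]
    · intro k _ hk
      rw [if_neg (by simp at hk; omega), mul_zero]
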